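/- For all integers s ≥ 1, k ≥ s, and 0 ≤ n ≤ s − 1, evaluating (ℰ₁ + ℰ₂)ⁿ(C′(k, s)) at 𝟙 gives ((ℰ₁+ℰ₂)ⁿ(C′(k, s)))(𝟙) = (k−1)!·(k+s)! / ((k−s)!·(k+s−n)!·(s−1−n)!). -/

import Mathlib

/- We model the polynomial ring `ℚ[y₁, y₂, …]` as `MvPolynomial ℕ ℚ`, the variable of
index `v` representing `y_{v+1}` (so `y_k = X (k-1)` for `k ≥ 1`). -/

open MvPolynomial

noncomputable section

/-- `ℰ₁ = ∑_{m,n ≥ 1} y_{m+n} ∂_m ∂_n`; in our indexing, with `a = m−1`, `b = n−1`,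
this is `∑_{a,b ≥ 0} X(a+b+1) ∂_{X a} ∂_{X b}` (cut off beyond the variables occurring
in the argument, losing no nonzero terms). -/
def E1 (p : MvPolynomial ℕ ℚ) : MvPolynomial ℕ ℚ :=
  ∑ a ∈ Finset.range (p.vars.sup id + 1), ∑ b ∈ Finset.range (p.vars.sup id + 1),
    X (a + b + 1) * pderiv a (pderiv b p)

/-- `ℰ₂ = ∑_{m,n ≥ 1} ((m+n)/2)·y_{m+n} ∂_m ∂_n`. -/
def E2 (p : MvPolynomial ℕ ℚ) : MvPolynomial ℕ ℚ :=
  ∑ a ∈ Finset.range (p.vars.sup id + 1), ∑ b ∈ Finset.range (p.vars.sup id + 1),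
    (((a : ℚ) + b + 2) / 2) • (X (a + b + 1) * pderiv a (pderiv b p))

/-- `C′(k, s) = ∑ y_{n₁}⋯y_{n_s}`, summed over ordered `s`-tuples of integers
`n_j ≥ 1` with `n₁ + ⋯ + n_s = k`. -/
def C'pol (k s : ℕ) : MvPolynomial ℕ ℚ :=
  ∑ m ∈ (Finset.Nat.antidiagonalTuple s k).filter (fun m => ∀ t, 1 ≤ m t),
    ∏ t, X (m t - 1)

theorem vars_pderiv_subset {σ R : Type*} [CommSemiring R] (i : σ) (p : MvPolynomial σ R) :
    (pderiv i p).vars ⊆ p.vars := by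
  intro j hj
  rw [mem_vars_iff_mem_support] at hj ⊢
  obtain ⟨d, hd, hjd⟩ := hj
  rw [mem_support_iff, coeff_pderiv] at hd
  refine ⟨d + Finsupp.single i 1, mem_support_iff.2 (left_ne_zero_of_mul hd), ?_⟩
  rw [Finsupp.mem_support_iff] at hjd ⊢
  simp [hjd]

/-- Euler's identity for a weighted homogeneous polynomial in possibly infinitely many
variables. -/
theorem sum_weight_mul_X_mul_pderiv {σ R : Type*} [CommSemiring R] {w : σ → R} {c : R}
    {p : MvPolynomial σ R} (hp : p.IsWeightedHomogeneous w c) {S : Finset σ} (hS : p.vars ⊆ S) :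
    ∑ i ∈ S, w i • (X i * pderiv i p) = c • p := by
  have key : ∀ i, X i * pderiv i p
      = ∑ d ∈ p.support, d i • monomial d (p.coeff d) := by
    intro i
    conv_lhs => rw [← support_sum_monomial_coeff p]
    rw [map_sum, Finset.mul_sum]
    exact Finset.sum_congr rfl fun d _ => X_mul_pderiv_monomial
  conv_rhs => rw [← support_sum_monomial_coeff p]
  simp_rw [key, Finset.smul_sum]
  rw [Finset.sum_comm]
  refine Finset.sum_congr rfl fun d hd => ?_
  rw [← hp (mem_support_iff.1 hd), Finsupp.weight_apply,
    Finsupp.sum_of_support_subset d ((support_subset_vars_of_mem_support hd).trans hS)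
      (fun i c => c • w i)
      (fun i _ => zero_smul _ _), Finset.sum_smul]
  refine Finset.sum_congr rfl fun i _ => ?_
  rw [smul_comm, smul_assoc]

theorem sum_weight_mul_eval_one_pderiv {σ R : Type*} [CommSemiring R] {w : σ → R} {c : R}
    {p : MvPolynomial σ R} (hp : p.IsWeightedHomogeneous w c) {S : Finset σ} (hS : p.vars ⊆ S) :
    ∑ i ∈ S, w i * eval (fun _ => (1 : R)) (pderiv i p) = c * eval (fun _ => (1 : R)) p := by
  simpa [smul_eval] using
    congrArg (eval fun _ => (1 : R)) (sum_weight_mul_X_mul_pderiv hp hS)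

/-- Every monomial of `p` has degree `s`, and weight `k` when `y_j` has weight `j`. -/
def IsBihomogeneous (s k : ℚ) (p : MvPolynomial ℕ ℚ) : Prop :=
  p.IsWeightedHomogeneous (fun _ => (1 : ℚ)) s ∧
    p.IsWeightedHomogeneous (fun i : ℕ => (i : ℚ) + 1) k

theorem E1_add_E2_eq (p : MvPolynomial ℕ ℚ) :
    E1 p + E2 p =
      ∑ a ∈ Finset.range (p.vars.sup id + 1), ∑ b ∈ Finset.range (p.vars.sup id + 1),
        (1 + ((a : ℚ) + b + 2) / 2) • (X (a + b + 1) * pderiv a (pderiv b p)) := by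
  simp only [E1, E2, ← Finset.sum_add_distrib, add_smul, one_smul]

theorem IsBihomogeneous.E1_add_E2 {s k : ℚ} {p : MvPolynomial ℕ ℚ} (hp : IsBihomogeneous s k p) :
    IsBihomogeneous (s - 1) k (E1 p + E2 p) := by
  have aux : ∀ (w : ℕ → ℚ) (c c' : ℚ), p.IsWeightedHomogeneous w c →
      (∀ a b, w (a + b + 1) + (c - w b - w a) = c') →
      (E1 p + E2 p).IsWeightedHomogeneous w c' := by
    intro w c c' h hc
    rw [E1_add_E2_eq]
    refine IsWeightedHomogeneous.sum _ _ _ fun a _ =>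
      IsWeightedHomogeneous.sum _ _ _ fun b _ => ?_
    rw [smul_eq_C_mul, ← hc a b]
    refine ((isWeightedHomogeneous_X ℚ w _).mul ?_).C_mul _
    exact (h.pderiv (sub_add_cancel c (w b))).pderiv (sub_add_cancel _ (w a))
  refine ⟨aux _ s _ hp.1 fun a b => by ring, aux _ k _ hp.2 fun a b => by push_cast; ring⟩

theorem eval_one_E1_add_E2 {s k : ℚ} {p : MvPolynomial ℕ ℚ} (hp : IsBihomogeneous s k p) :
    eval (fun _ => (1 : ℚ)) (E1 p + E2 p)
      = (s - 1) * (s + k) * eval (fun _ => (1 : ℚ)) p := by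
  set S := Finset.range (p.vars.sup id + 1) with hS
  have hpS : p.vars ⊆ S := fun i hi =>
    Finset.mem_range.2 (Nat.lt_succ_of_le (Finset.le_sup (f := id) hi))
  have inner : ∀ b, ∑ a ∈ S, eval (fun _ => (1 : ℚ)) (pderiv a (pderiv b p))
      = (s - 1) * eval (fun _ => (1 : ℚ)) (pderiv b p) := fun b => by
    simpa using sum_weight_mul_eval_one_pderiv
      (hp.1.pderiv (i := b) (sub_add_cancel s 1)) ((vars_pderiv_subset b p).trans hpS)
  have inner' : ∀ b, ∑ a ∈ S, ((a : ℚ) + 1) * eval (fun _ => (1 : ℚ)) (pderiv a (pderiv b p))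
      = (k - (b + 1)) * eval (fun _ => (1 : ℚ)) (pderiv b p) := fun b =>
    sum_weight_mul_eval_one_pderiv
      (hp.2.pderiv (i := b) (sub_add_cancel k _)) ((vars_pderiv_subset b p).trans hpS)
  have outer : ∑ b ∈ S, eval (fun _ => (1 : ℚ)) (pderiv b p)
      = s * eval (fun _ => (1 : ℚ)) p := by
    simpa using sum_weight_mul_eval_one_pderiv hp.1 hpS
  have outer' : ∑ b ∈ S, ((b : ℚ) + 1) * eval (fun _ => (1 : ℚ)) (pderiv b p)
      = k * eval (fun _ => (1 : ℚ)) p :=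
    sum_weight_mul_eval_one_pderiv hp.2 hpS
  rw [E1_add_E2_eq, ← hS, Finset.sum_comm, map_sum]
  have step : ∀ b ∈ S, eval (fun _ => (1 : ℚ)) (∑ a ∈ S,
        (1 + ((a : ℚ) + b + 2) / 2) • (X (a + b + 1) * pderiv a (pderiv b p)))
      = (s - 1 + k / 2) * eval (fun _ => (1 : ℚ)) (pderiv b p)
        + (s - 2) / 2 * (((b : ℚ) + 1) * eval (fun _ => (1 : ℚ)) (pderiv b p)) := by
    intro b _
    have : ∀ a ∈ S, eval (fun _ => (1 : ℚ))
        ((1 + ((a : ℚ) + b + 2) / 2) • (X (a + b + 1) * pderiv a (pderiv b p)))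
        = (1 + ((b : ℚ) + 1) / 2) * eval (fun _ => (1 : ℚ)) (pderiv a (pderiv b p))
          + 1 / 2 * (((a : ℚ) + 1) * eval (fun _ => (1 : ℚ)) (pderiv a (pderiv b p))) := by
      intro a _
      rw [smul_eval, eval_mul, eval_X]
      ring
    rw [map_sum, Finset.sum_congr rfl this, Finset.sum_add_distrib, ← Finset.mul_sum,
      ← Finset.mul_sum, inner, inner']
    ring
  rw [Finset.sum_congr rfl step, Finset.sum_add_distrib, ← Finset.mul_sum, ← Finset.mul_sum,
    outer, outer']
  ring

theorem IsBihomogeneous.iterate_E1_add_E2 {s k : ℚ} {p : MvPolynomial ℕ ℚ}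
    (hp : IsBihomogeneous s k p) (n : ℕ) :
    IsBihomogeneous (s - n) k ((fun p => E1 p + E2 p)^[n] p) := by
  induction n with
  | zero => simpa using hp
  | succ n ih =>
    rw [Function.iterate_succ_apply']
    convert ih.E1_add_E2 using 1
    push_cast; ring

theorem eval_one_iterate_E1_add_E2 {s k : ℕ} {p : MvPolynomial ℕ ℚ}
    (hp : IsBihomogeneous s k p) {n : ℕ} (hn : n + 1 ≤ s) :
    eval (fun _ => (1 : ℚ)) ((fun p => E1 p + E2 p)^[n] p)
      = (s - 1).descFactorial n * (k + s).descFactorial n * eval (fun _ => (1 : ℚ)) p := by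
  induction n with
  | zero => simp
  | succ n ih =>
    rw [Function.iterate_succ_apply', eval_one_E1_add_E2 (hp.iterate_E1_add_E2 n),
      ih (by omega), Nat.descFactorial_succ, Nat.descFactorial_succ]
    push_cast [Nat.cast_sub (show n ≤ s - 1 by omega), Nat.cast_sub (show 1 ≤ s by omega),
      Nat.cast_sub (show n ≤ k + s by omega)]
    ring

theorem isBihomogeneous_C'pol (k s : ℕ) : IsBihomogeneous s k (C'pol k s) := by
  have aux : ∀ (w : ℕ → ℚ) (c : ℚ),
      (∀ m ∈ (Finset.Nat.antidiagonalTuple s k).filter (fun m => ∀ t, 1 ≤ m t),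
        ∑ t, w (m t - 1) = c) → (C'pol k s).IsWeightedHomogeneous w c := by
    intro w c h
    refine IsWeightedHomogeneous.sum _ _ _ fun m hm => ?_
    rw [← h m hm]
    exact IsWeightedHomogeneous.prod _ _ _ fun t _ => isWeightedHomogeneous_X ℚ w _
  refine ⟨aux _ _ fun m _ => by simp, aux _ _ fun m hm => ?_⟩
  rw [Finset.mem_filter, Finset.Nat.mem_antidiagonalTuple] at hm
  rw [← hm.1, Nat.cast_sum]
  refine Finset.sum_congr rfl fun t _ => ?_
  rw [Nat.cast_sub (hm.2 t)]
  simp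

/-- The number of compositions of `k` into `s` positive parts. -/
theorem card_filter_antidiagonalTuple_one_le {s k : ℕ} (hk : s ≤ k) :
    ((Finset.Nat.antidiagonalTuple s k).filter (fun m => ∀ t, 1 ≤ m t)).card
      = (k - 1).choose (k - s) := by
  have h := Finset.card_finsuppAntidiag_nat_eq_choose (s := (Finset.univ : Finset (Fin s))) (k - s)
  rw [Finset.card_univ, Fintype.card_fin, Nat.add_sub_cancel' hk] at h
  rw [← h]
  symm
  refine Finset.card_bij' (fun f _ t => f t + 1)
    (fun m _ => Finsupp.equivFunOnFinite.symm fun t => m t - 1) ?_ ?_ ?_ ?_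
  · intro f hf
    have hf' := (Finset.mem_finsuppAntidiag.1 hf).1
    simp only [Finset.mem_filter, Finset.Nat.mem_antidiagonalTuple]
    refine ⟨?_, fun t => by omega⟩
    rw [Finset.sum_add_distrib, hf']
    simp [hk]
  · intro m hm
    simp only [Finset.mem_filter, Finset.Nat.mem_antidiagonalTuple] at hm
    refine Finset.mem_finsuppAntidiag.2 ⟨?_, Finset.subset_univ _⟩
    have : ∑ t, (m t - 1) + s = k := by
      rw [← hm.1]
      conv_rhs => rw [Finset.sum_congr rfl fun t _ => (Nat.sub_add_cancel (hm.2 t)).symm]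
      simp [Finset.sum_add_distrib]
    simp only [Finsupp.equivFunOnFinite_symm_apply_apply]
    omega
  · intro f _
    ext t
    simp
  · intro m hm
    ext t
    simpa using Nat.sub_add_cancel ((Finset.mem_filter.1 hm).2 t)

theorem eval_one_C'pol {s k : ℕ} (hk : s ≤ k) :
    eval (fun _ => (1 : ℚ)) (C'pol k s) = (k - 1).choose (k - s) := by
  simp [C'pol, map_sum, map_prod, ← card_filter_antidiagonalTuple_one_le hk]

/-- for `s ≥ 1`, `k ≥ s` and `0 ≤ n ≤ s − 1`,
`((ℰ₁+ℰ₂)ⁿ(C′(k, s)))(𝟙) = (k−1)!·(k+s)! / ((k−s)!·(k+s−n)!·(s−1−n)!)`. -/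
theorem stmt12 (s k n : ℕ) (hs : 1 ≤ s) (hk : s ≤ k) (hn : n ≤ s - 1) :
    eval (fun _ => (1 : ℚ)) ((fun p => E1 p + E2 p)^[n] (C'pol k s)) =
      ((k - 1).factorial : ℚ) * (k + s).factorial /
        (((k - s).factorial : ℚ) * (k + s - n).factorial * (s - 1 - n).factorial) := by
  rw [eval_one_iterate_E1_add_E2 (isBihomogeneous_C'pol k s) (by omega), eval_one_C'pol hk,
    Nat.cast_choose ℚ (show k - s ≤ k - 1 by omega), show k - 1 - (k - s) = s - 1 by omega,
    ← Nat.factorial_mul_descFactorial hn,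
    ← Nat.factorial_mul_descFactorial (show n ≤ k + s by omega)]
  have h₁ : ((s - 1).descFactorial n : ℚ) ≠ 0 := by
    simpa [Nat.descFactorial_eq_zero_iff_lt] using hn
  push_cast
  field_simp
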